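/- Let (X,d) be a proper length metric space, K : X → [0,∞) continuous with Σ := {K = 0} finite, and suppose K(x) ≥ k(d(x,Σ)) for some continuous k : [0,∞) → [0,∞) with ∫_0^∞ k(t) dt = +∞. Then d_K is a metric on X: d_K is finite, symmetric, satisfies the triangle inequality, d_K(x,x) = 0, and d_K(x,y) > 0 whenever x ≠ y. -/

import Mathlib

open Filter Topology MeasureTheory Set
open scoped ENNReal NNReal Classical

section Defs

variable {X : Type*} [MetricSpace X]

/-- The metric derivative of the curve `γ` within the set `I` at the point `t` exists and has
value `L`, i.e. `lim_{s → t, s ∈ I} dist (γ s) (γ t) / |s - t| = L`. -/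
def HasMetricDerivWithinAt (γ : ℝ → X) (I : Set ℝ) (t : ℝ) (L : ℝ) : Prop :=
  Tendsto (fun s => dist (γ s) (γ t) / |s - t|) (𝓝[I \ {t}] t) (𝓝 L)

/-- The metric derivative `|γ̇|(t)` of `γ` within `I` at `t` (junk value `0` if the defining
limit does not exist). -/
noncomputable def metricDerivWithin (γ : ℝ → X) (I : Set ℝ) (t : ℝ) : ℝ :=
  if h : ∃ L, HasMetricDerivWithinAt γ I t L then h.choose else 0

/-- `γ` is locally Lipschitz on the set `s ⊆ ℝ`. -/
def LocallyLipschitzOnSet (γ : ℝ → X) (s : Set ℝ) : Prop :=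
  ∀ t ∈ s, ∃ ε > 0, ∃ C : NNReal, LipschitzOnWith C γ (s ∩ Metric.ball t ε)

/-- `γ` is a piecewise locally Lipschitz curve on the interval `I`: it is continuous on `I`
and locally Lipschitz outside finitely many points of `I` (equivalently, there are
`t_0 = inf I < t_1 < ⋯ < t_n = sup I` such that `γ` is locally Lipschitz on each
`I ∩ (t_i, t_(i+1))`). -/
def PiecewiseLocLipOn (γ : ℝ → X) (I : Set ℝ) : Prop :=
  ContinuousOn γ I ∧ ∃ S : Finset ℝ, LocallyLipschitzOnSet γ (I \ ↑S)

/-- The `K`-weighted length `L_K(γ) = ∫_I K (γ t) * |γ̇| t dt` of a curve `γ` defined on `I`. -/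
noncomputable def KLength (K : X → ℝ) (γ : ℝ → X) (I : Set ℝ) : ℝ≥0∞ :=
  ∫⁻ t in I, ENNReal.ofReal (K (γ t) * metricDerivWithin γ I t)

/-- The filter of approach to the left endpoint of the interval `I` (the endpoint may be
`-∞`, i.e. `I` may be unbounded below). -/
noncomputable def leftEndFilter (I : Set ℝ) : Filter ℝ :=
  if BddBelow I then 𝓝[I] (sInf I) else Filter.atBot ⊓ Filter.principal I

/-- The filter of approach to the right endpoint of the interval `I`. -/
noncomputable def rightEndFilter (I : Set ℝ) : Filter ℝ :=
  if BddAbove I then 𝓝[I] (sSup I) else Filter.atTop ⊓ Filter.principal I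

/-- `γ`, defined on the nonempty interval `I`, is a path from `x` to `y`: it is continuous on
`I` and converges to `x` (resp. `y`) at the left (resp. right) endpoint of `I` (where the
value at an infinite endpoint is understood as a limit). -/
def IsPathOn (γ : ℝ → X) (I : Set ℝ) (x y : X) : Prop :=
  I.Nonempty ∧ I.OrdConnected ∧ ContinuousOn γ I ∧
    Tendsto γ (leftEndFilter I) (𝓝 x) ∧ Tendsto γ (rightEndFilter I) (𝓝 y)

/-- The weighted (pseudo-)distance `d_K(x,y)`: the infimum of `L_K` over piecewise locally
Lipschitz paths from `x` to `y`. -/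
noncomputable def dK (K : X → ℝ) (x y : X) : ℝ≥0∞ :=
  ⨅ (γ : ℝ → X) (I : Set ℝ) (_ : PiecewiseLocLipOn γ I) (_ : IsPathOn γ I x y),
    KLength K γ I

/-- The intrinsic (geodesic) distance: the infimum of the length `L_d(γ) = eVariationOn γ I`
over all paths from `x` to `y`. -/
noncomputable def geodDist (x y : X) : ℝ≥0∞ :=
  ⨅ (γ : ℝ → X) (I : Set ℝ) (_ : IsPathOn γ I x y), eVariationOn γ I

/-- A length space: the distance coincides with the intrinsic distance. -/
def IsLengthSpace (Y : Type*) [MetricSpace Y] : Prop :=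
  ∀ x y : Y, geodDist x y = edist x y

/-- `K_r(x) := inf { K z : dist x z ≤ r }`. -/
noncomputable def Kinf (K : X → ℝ) (x : X) (r : ℝ) : ℝ :=
  sInf (K '' Metric.closedBall x r)

/-- `K^r(x) := sup { K z : dist x z ≤ r }`. -/
noncomputable def Ksup (K : X → ℝ) (x : X) (r : ℝ) : ℝ :=
  sSup (K '' Metric.closedBall x r)

/-- The energy `E_W(γ) = ∫_I (½ |γ̇|(t)² + W (γ t)) dt`. -/
noncomputable def energyW (W : X → ℝ) (γ : ℝ → X) (I : Set ℝ) : ℝ≥0∞ :=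
  ∫⁻ t in I, ENNReal.ofReal ((metricDerivWithin γ I t) ^ 2 / 2 + W (γ t))

end Defs

section MetricDerivative

variable {X : Type*} [MetricSpace X]

theorem metricDerivWithin_eq_of_iff {γ δ : ℝ → X} {I J : Set ℝ} {t u : ℝ}
    (h : ∀ L, HasMetricDerivWithinAt γ I t L ↔ HasMetricDerivWithinAt δ J u L) :
    metricDerivWithin γ I t = metricDerivWithin δ J u := by
  have hPQ : HasMetricDerivWithinAt γ I t = HasMetricDerivWithinAt δ J u :=
    funext fun L => propext (h L)
  have key : ∀ P Q : ℝ → Prop, P = Q →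
      (if h : ∃ L, P L then h.choose else 0) = if h : ∃ L, Q L then h.choose else 0 := by
    rintro P _ rfl
    rfl
  exact key _ _ hPQ

theorem HasMetricDerivWithinAt.metricDerivWithin_univ_eq {γ : ℝ → X} {t L : ℝ}
    (h : HasMetricDerivWithinAt γ univ t L) : metricDerivWithin γ univ t = L := by
  have hex : ∃ L, HasMetricDerivWithinAt γ univ t L := ⟨L, h⟩
  have huniq : ∀ M, HasMetricDerivWithinAt γ univ t M → M = L := by
    intro M hM
    rw [HasMetricDerivWithinAt, ← compl_eq_univ_sdiff] at h hM
    exact tendsto_nhds_unique hM h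
  rw [metricDerivWithin, dif_pos hex]
  exact huniq _ hex.choose_spec

/-- In the interior of `I` the metric derivative within `I` is the two-sided one. -/
theorem metricDerivWithin_of_mem_nhds {γ δ : ℝ → X} {I : Set ℝ} {t : ℝ} (hI : I ∈ 𝓝 t)
    (hγ : γ =ᶠ[𝓝 t] δ) : metricDerivWithin γ I t = metricDerivWithin δ univ t := by
  refine metricDerivWithin_eq_of_iff fun L => ?_
  have hf : 𝓝[I \ {t}] t = 𝓝[univ \ {t}] t := by
    rw [← compl_eq_univ_sdiff, sdiff_eq, inter_comm, nhdsWithin_inter_of_mem' (nhdsWithin_le_nhds hI)]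
  rw [HasMetricDerivWithinAt, HasMetricDerivWithinAt, hf, hγ.eq_of_nhds]
  refine tendsto_congr' ?_
  filter_upwards [nhdsWithin_le_nhds hγ] with s hs
  rw [hs]

theorem metricDerivWithin_univ_le {γ : ℝ → X} {t : ℝ} {C : ℝ≥0} {s : Set ℝ} (hs : s ∈ 𝓝 t)
    (hγ : LipschitzOnWith C γ s) : metricDerivWithin γ univ t ≤ C := by
  by_cases hex : ∃ L, HasMetricDerivWithinAt γ univ t L
  · obtain ⟨L, h⟩ := hex
    rw [h.metricDerivWithin_univ_eq]
    rw [HasMetricDerivWithinAt, ← compl_eq_univ_sdiff] at h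
    refine le_of_tendsto h ?_
    filter_upwards [nhdsWithin_le_nhds hs, self_mem_nhdsWithin] with r hr hne
    rw [div_le_iff₀ (abs_pos.2 (sub_ne_zero.2 hne)), ← Real.dist_eq]
    exact hγ.dist_le_mul r hr t (mem_of_mem_nhds hs)
  · rw [metricDerivWithin, dif_neg hex]
    exact C.2

theorem map_nhdsNE_of_hasStrictDerivAt {ψ : ℝ → ℝ} {u c : ℝ} (h : HasStrictDerivAt ψ c u)
    (hc : c ≠ 0) : map ψ (𝓝[≠] u) = 𝓝[≠] (ψ u) := by
  refine le_antisymm (h.hasDerivAt.tendsto_nhdsNE hc) fun s hs => ?_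
  rw [mem_map, mem_nhdsWithin_iff_eventually] at hs
  rw [mem_nhdsWithin_iff_eventually, ← h.map_nhds_eq hc, eventually_map]
  filter_upwards [hs] with v hv hne
  exact hv fun h => hne (by rw [mem_singleton_iff.1 h]; rfl)

/-- Chain rule for the metric derivative under a change of parameter. -/
theorem metricDerivWithin_comp {γ : ℝ → X} {ψ : ℝ → ℝ} {u c : ℝ} (h : HasStrictDerivAt ψ c u)
    (hc : c ≠ 0) :
    metricDerivWithin (γ ∘ ψ) univ u = |c| * metricDerivWithin γ univ (ψ u) := by
  have hq : Tendsto (fun v => |ψ v - ψ u| / |v - u|) (𝓝[≠] u) (𝓝 |c|) := by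
    have := (hasDerivAt_iff_tendsto_slope.1 h.hasDerivAt).abs
    refine this.congr fun v => ?_
    rw [slope_def_field, abs_div]
  have hne : ∀ᶠ v in 𝓝[≠] u, ψ v ≠ ψ u := by
    have := h.hasDerivAt.tendsto_nhdsNE hc
    exact this self_mem_nhdsWithin
  have key : ∀ L, HasMetricDerivWithinAt γ univ (ψ u) L ↔
      Tendsto (fun v => dist (γ (ψ v)) (γ (ψ u)) / |ψ v - ψ u|) (𝓝[≠] u) (𝓝 L) := by
    intro L
    rw [HasMetricDerivWithinAt, ← compl_eq_univ_sdiff, ← map_nhdsNE_of_hasStrictDerivAt h hc,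
      tendsto_map'_iff]
    rfl
  have hto : ∀ L, HasMetricDerivWithinAt γ univ (ψ u) L →
      HasMetricDerivWithinAt (γ ∘ ψ) univ u (|c| * L) := by
    intro L hL
    rw [HasMetricDerivWithinAt, ← compl_eq_univ_sdiff]
    refine (hq.mul ((key L).1 hL)).congr' ?_
    filter_upwards [hne] with v hv
    have : |ψ v - ψ u| ≠ 0 := abs_ne_zero.2 (sub_ne_zero.2 hv)
    simp only [Function.comp]
    field_simp
  by_cases hex : ∃ L, HasMetricDerivWithinAt γ univ (ψ u) L
  · obtain ⟨L, hL⟩ := hex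
    rw [hL.metricDerivWithin_univ_eq, (hto L hL).metricDerivWithin_univ_eq]
  · have hex' : ¬ ∃ M, HasMetricDerivWithinAt (γ ∘ ψ) univ u M := by
      rintro ⟨M, hM⟩
      refine hex ⟨M / |c|, (key _).2 ?_⟩
      rw [HasMetricDerivWithinAt, ← compl_eq_univ_sdiff] at hM
      refine (hM.div hq (abs_ne_zero.2 hc)).congr' ?_
      filter_upwards [hne, self_mem_nhdsWithin] with v hv hvu
      have h1 : |ψ v - ψ u| ≠ 0 := abs_ne_zero.2 (sub_ne_zero.2 hv)
      have h2 : |v - u| ≠ 0 := abs_ne_zero.2 (sub_ne_zero.2 hvu)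
      simp only [Function.comp, Pi.div_apply]
      field_simp
    rw [metricDerivWithin, metricDerivWithin, dif_neg hex, dif_neg hex', mul_zero]

theorem metricDerivWithin_univ_const (x : X) (t : ℝ) :
    metricDerivWithin (fun _ => x) univ t = 0 := by
  refine HasMetricDerivWithinAt.metricDerivWithin_univ_eq ?_
  simp [HasMetricDerivWithinAt, tendsto_const_nhds]

/-- Lipschitz curves in a metric space are metrically differentiable almost everywhere. -/
theorem LipschitzWith.ae_exists_hasMetricDeriv {γ : ℝ → X} {C : ℝ≥0} (hγ : LipschitzWith C γ) :
    ∀ᵐ t, ∃ L, HasMetricDerivWithinAt γ univ t L := by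
  set f : ℚ → ℝ → ℝ := fun q t => dist (γ q) (γ t) with hf
  have hfL : ∀ q, LipschitzWith C (f q) := fun q => by
    simpa [hf, Function.comp_def] using (LipschitzWith.dist_right (γ q)).comp hγ
  have hfd : ∀ q t, |deriv (f q) t| ≤ C := fun q t => by
    rw [← Real.norm_eq_abs]
    exact norm_deriv_le_of_lipschitz (hfL q)
  set m : ℝ → ℝ := fun t => ⨆ q, |deriv (f q) t| with hm
  have hbdd : ∀ t, BddAbove (range fun q => |deriv (f q) t|) := fun t =>
    ⟨C, by rintro _ ⟨q, rfl⟩; exact hfd q t⟩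
  have hm0 : ∀ t, 0 ≤ m t := fun t => Real.iSup_nonneg fun q => abs_nonneg _
  have hmC : ∀ t, m t ≤ C := fun t => ciSup_le fun q => hfd q t
  have hmm : Measurable m := Measurable.iSup fun q => (measurable_deriv (f q)).norm
  have hmi : LocallyIntegrable m volume := by
    refine (locallyIntegrable_const (C : ℝ)).mono hmm.aestronglyMeasurable ?_
    refine Eventually.of_forall fun t => ?_
    rw [Real.norm_of_nonneg (hm0 t), Real.norm_of_nonneg C.coe_nonneg]
    exact hmC t
  have hmii : ∀ a b, IntervalIntegrable m volume a b := fun a b =>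
    (hmi.integrableOn_isCompact isCompact_uIcc).intervalIntegrable
  have hle : ∀ s t, dist (γ s) (γ t) ≤ |∫ r in t..s, m r| := by
    intro s t
    have hq : ∀ q : ℚ, dist (γ q) (γ s) - dist (γ q) (γ t) ≤ |∫ r in t..s, m r| := by
      intro q
      have hac := (hfL q).lipschitzOnWith (s := uIcc t s) |>.absolutelyContinuousOnInterval
      have := hac.integral_deriv_eq_sub
      calc f q s - f q t = ∫ r in t..s, deriv (f q) r := this.symm
        _ ≤ |∫ r in t..s, deriv (f q) r| := le_abs_self _
        _ ≤ |∫ r in t..s, m r| := by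
          rw [← Real.norm_eq_abs]
          refine intervalIntegral.norm_integral_le_abs_of_norm_le ?_ (hmii t s)
          exact Eventually.of_forall fun r => le_ciSup (hbdd r) q
    have hall : ∀ r : ℝ, dist (γ r) (γ s) - dist (γ r) (γ t) ≤ |∫ r in t..s, m r| := by
      intro r
      refine Rat.isDenseEmbedding_coe_real.dense.induction (P := fun r => dist (γ r) (γ s) -
        dist (γ r) (γ t) ≤ |∫ r in t..s, m r|) ?_ ?_ r
      · rintro _ ⟨q, rfl⟩
        exact hq q
      · have := hγ.continuous
        exact isClosed_le (by fun_prop) continuous_const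
    simpa [dist_comm] using hall t
  have hdiff : ∀ᵐ t, ∀ q, DifferentiableAt ℝ (f q) t :=
    ae_all_iff.2 fun q => (hfL q).ae_differentiableAt_real
  filter_upwards [hdiff, LocallyIntegrable.ae_hasDerivAt_integral hmi] with t ht hG
  refine ⟨m t, ?_⟩
  rw [HasMetricDerivWithinAt, ← compl_eq_univ_sdiff]
  refine tendsto_order.2 ⟨fun l hl => ?_, fun u hu => ?_⟩
  · obtain ⟨q, hq⟩ := exists_lt_of_lt_ciSup hl
    have := (hasDerivAt_iff_tendsto_slope.1 (ht q).hasDerivAt).abs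
    filter_upwards [this.eventually (lt_mem_nhds hq), self_mem_nhdsWithin] with s hs hne
    refine hs.trans_le ?_
    rw [slope_def_field, abs_div]
    gcongr
    rw [dist_comm (γ s)]
    simpa [hf, dist_comm] using abs_dist_sub_le (γ s) (γ t) (γ q)
  · have := (hasDerivAt_iff_tendsto_slope.1 (hG t)).abs
    rw [abs_of_nonneg (hm0 t)] at this
    filter_upwards [this.eventually (gt_mem_nhds hu), self_mem_nhdsWithin] with s hs hne
    refine lt_of_le_of_lt ?_ hs
    rw [slope_def_field, abs_div, intervalIntegral.integral_same, sub_zero]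
    gcongr
    exact hle s t

end MetricDerivative

section Arcs

variable {X : Type*} [MetricSpace X]

theorem LocallyLipschitzOnSet.mono {γ : ℝ → X} {s t : Set ℝ} (h : LocallyLipschitzOnSet γ t)
    (hst : s ⊆ t) : LocallyLipschitzOnSet γ s := fun r hr => by
  obtain ⟨ε, hε, C, hC⟩ := h r (hst hr)
  exact ⟨ε, hε, C, hC.mono (inter_subset_inter_left _ hst)⟩

theorem LocallyLipschitzOnSet.congr {γ δ : ℝ → X} {s : Set ℝ} (h : LocallyLipschitzOnSet γ s)
    (hδ : EqOn δ γ s) : LocallyLipschitzOnSet δ s := fun r hr => by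
  obtain ⟨ε, hε, C, hC⟩ := h r hr
  refine ⟨ε, hε, C, fun u hu v hv => ?_⟩
  rw [hδ hu.1, hδ hv.1]
  exact hC hu hv

theorem locallyLipschitzOnSet_of_nhds {γ : ℝ → X} {s : Set ℝ}
    (h : ∀ t ∈ s, ∃ U ∈ 𝓝 t, LocallyLipschitzOnSet γ (s ∩ U)) : LocallyLipschitzOnSet γ s := by
  intro t ht
  obtain ⟨U, hU, hl⟩ := h t ht
  obtain ⟨ε, hε, C, hC⟩ := hl t ⟨ht, mem_of_mem_nhds hU⟩
  obtain ⟨r, hr, hrU⟩ := Metric.mem_nhds_iff.1 hU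
  refine ⟨min ε r, lt_min hε hr, C, hC.mono ?_⟩
  rintro v ⟨hv, hvb⟩
  exact ⟨⟨hv, hrU (Metric.ball_subset_ball (min_le_right _ _) hvb)⟩,
    Metric.ball_subset_ball (min_le_left _ _) hvb⟩

theorem LocallyLipschitzOnSet.comp {γ : ℝ → X} {s J : Set ℝ} {ψ ψ' : ℝ → ℝ}
    (h : LocallyLipschitzOnSet γ s) (hψ : ∀ u ∈ J, HasStrictDerivAt ψ (ψ' u) u)
    (hJ : MapsTo ψ J s) : LocallyLipschitzOnSet (γ ∘ ψ) J := by
  intro u hu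
  obtain ⟨ε, hε, C, hC⟩ := h (ψ u) (hJ hu)
  obtain ⟨C', U, hU, hC'⟩ := (hψ u hu).hasStrictFDerivAt.exists_lipschitzOnWith
  have hpre : ψ ⁻¹' Metric.ball (ψ u) ε ∈ 𝓝 u :=
    (hψ u hu).hasDerivAt.continuousAt (Metric.ball_mem_nhds _ hε)
  obtain ⟨r, hr, hrU⟩ := Metric.mem_nhds_iff.1 (inter_mem hU hpre)
  refine ⟨r, hr, C * C', hC.comp (hC'.mono fun v hv => (hrU hv.2).1) ?_⟩
  exact fun v hv => ⟨hJ hv.1, (hrU hv.2).2⟩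

/-- The `K`-weighted length of `γ` over the set `s`, computed with the two-sided metric
derivative. -/
noncomputable def weightedLength (K : X → ℝ) (γ : ℝ → X) (s : Set ℝ) : ℝ≥0∞ :=
  ∫⁻ t in s, ENNReal.ofReal (K (γ t) * metricDerivWithin γ univ t)

theorem KLength_eq_weightedLength (K : X → ℝ) (γ : ℝ → X) {I : Set ℝ} (hI : I.OrdConnected) :
    KLength K γ I = weightedLength K γ I := by
  have hae : (interior I : Set ℝ) =ᵐ[volume] I := by
    rcases I.subsingleton_or_nontrivial with h | h
    · have h0 : volume I = 0 := h.measure_zero _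
      exact (measure_mono_null interior_subset h0 |> ae_eq_empty.2).trans (ae_eq_empty.2 h0).symm
    · exact interior_ae_eq_of_null_frontier (hI.convex.addHaar_frontier volume)
  rw [KLength, weightedLength, ← setLIntegral_congr hae, ← setLIntegral_congr hae]
  refine setLIntegral_congr_fun isOpen_interior.measurableSet fun t ht => ?_
  simp only [metricDerivWithin_of_mem_nhds (mem_interior_iff_mem_nhds.1 ht) (EventuallyEq.refl _ γ)]

theorem weightedLength_congr (K : X → ℝ) {γ δ : ℝ → X} {s : Set ℝ} (hs : IsOpen s)
    (h : EqOn γ δ s) : weightedLength K γ s = weightedLength K δ s := by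
  refine setLIntegral_congr_fun hs.measurableSet fun t ht => ?_
  simp only [h ht, metricDerivWithin_of_mem_nhds univ_mem
    (h.eventuallyEq_of_mem (hs.mem_nhds ht))]

/-- The weighted length is invariant under changes of parameter. -/
theorem weightedLength_comp (K : X → ℝ) (γ : ℝ → X) {J : Set ℝ} {ψ ψ' : ℝ → ℝ}
    (hJ : MeasurableSet J) (hψ : ∀ u ∈ J, HasStrictDerivAt ψ (ψ' u) u) (hψ0 : ∀ u ∈ J, ψ' u ≠ 0)
    (hinj : InjOn ψ J) : weightedLength K (γ ∘ ψ) J = weightedLength K γ (ψ '' J) := by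
  rw [weightedLength, weightedLength, lintegral_image_eq_lintegral_abs_deriv_mul hJ
    (fun u hu => (hψ u hu).hasDerivAt.hasDerivWithinAt) hinj]
  refine setLIntegral_congr_fun hJ fun u hu => ?_
  simp only [metricDerivWithin_comp (hψ u hu) (hψ0 u hu), Function.comp]
  rw [← ENNReal.ofReal_mul (abs_nonneg _)]
  congr 1
  ring

/-- A piecewise locally Lipschitz curve on `[a, b]` from `x` to `y`. -/
structure IsArc (γ : ℝ → X) (a b : ℝ) (x y : X) : Prop where
  lt : a < b
  continuousOn : ContinuousOn γ (Icc a b)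
  left : γ a = x
  right : γ b = y
  locallyLipschitz : ∃ S : Finset ℝ, LocallyLipschitzOnSet γ (Ioo a b \ ↑S)

theorem IsArc.dK_le (K : X → ℝ) {γ : ℝ → X} {a b : ℝ} {x y : X} (h : IsArc γ a b x y) :
    dK K x y ≤ weightedLength K γ (Ioo a b) := by
  have hpl : PiecewiseLocLipOn γ (Icc a b) := by
    refine ⟨h.continuousOn, ?_⟩
    obtain ⟨S, hS⟩ := h.locallyLipschitz
    refine ⟨insert a (insert b S), hS.mono ?_⟩
    rintro t ⟨⟨h1, h2⟩, h3⟩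
    simp only [Finset.coe_insert, mem_insert_iff, not_or] at h3
    exact ⟨⟨lt_of_le_of_ne h1 (Ne.symm h3.1), lt_of_le_of_ne h2 h3.2.1⟩, h3.2.2⟩
  have hpath : IsPathOn γ (Icc a b) x y := by
    refine ⟨nonempty_Icc.2 h.lt.le, ordConnected_Icc, h.continuousOn, ?_, ?_⟩
    · rw [leftEndFilter, if_pos bddBelow_Icc, csInf_Icc h.lt.le, ← h.left]
      exact h.continuousOn a (left_mem_Icc.2 h.lt.le)
    · rw [rightEndFilter, if_pos bddAbove_Icc, csSup_Icc h.lt.le, ← h.right]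
      exact h.continuousOn b (right_mem_Icc.2 h.lt.le)
  calc dK K x y ≤ KLength K γ (Icc a b) :=
        iInf_le_of_le γ <| iInf_le_of_le _ <| iInf_le_of_le hpl <| iInf_le _ hpath
    _ = weightedLength K γ (Icc a b) := KLength_eq_weightedLength K γ ordConnected_Icc
    _ = weightedLength K γ (Ioo a b) := (setLIntegral_congr Ioo_ae_eq_Icc).symm

theorem isArc_const (x : X) : IsArc (fun _ => x) 0 1 x x where
  lt := one_pos
  continuousOn := continuousOn_const
  left := rfl
  right := rfl
  locallyLipschitz := ⟨∅, fun _ _ => ⟨1, one_pos, 0, LipschitzWith.const x |>.lipschitzOnWith⟩⟩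

theorem weightedLength_const (K : X → ℝ) (x : X) (s : Set ℝ) :
    weightedLength K (fun _ => x) s = 0 := by
  simp [weightedLength, metricDerivWithin_univ_const]

theorem IsArc.reverse {γ : ℝ → X} {a b : ℝ} {x y : X} (h : IsArc γ a b x y) :
    IsArc (γ ∘ Neg.neg) (-b) (-a) y x where
  lt := neg_lt_neg h.lt
  continuousOn := h.continuousOn.comp continuousOn_neg fun t ht =>
    ⟨by linarith [ht.2], by linarith [ht.1]⟩
  left := by simp [h.right]
  right := by simp [h.left]
  locallyLipschitz := by
    obtain ⟨S, hS⟩ := h.locallyLipschitz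
    refine ⟨S.image Neg.neg, hS.comp (fun u _ => hasStrictDerivAt_neg u) ?_⟩
    rintro t ⟨ht, htS⟩
    refine ⟨⟨by linarith [ht.2], by linarith [ht.1]⟩, fun hmem => htS ?_⟩
    rw [Finset.coe_image]
    exact ⟨-t, hmem, neg_neg t⟩

theorem weightedLength_reverse (K : X → ℝ) (γ : ℝ → X) (a b : ℝ) :
    weightedLength K (γ ∘ Neg.neg) (Ioo (-b) (-a)) = weightedLength K γ (Ioo a b) := by
  rw [weightedLength_comp K γ measurableSet_Ioo (fun u _ => hasStrictDerivAt_neg u)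
    (fun _ _ => by norm_num) neg_injective.injOn]
  simp

theorem IsArc.translate {γ : ℝ → X} {a b : ℝ} {x y : X} (h : IsArc γ a b x y) (c : ℝ) :
    IsArc (γ ∘ (· + c)) (a - c) (b - c) x y where
  lt := sub_lt_sub_right h.lt c
  continuousOn := h.continuousOn.comp (by fun_prop) fun t ht =>
    ⟨by linarith [ht.1], by linarith [ht.2]⟩
  left := by simp [h.left]
  right := by simp [h.right]
  locallyLipschitz := by
    obtain ⟨S, hS⟩ := h.locallyLipschitz
    refine ⟨S.image (· - c), hS.comp (fun u _ => (hasStrictDerivAt_id u).add_const c) ?_⟩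
    rintro t ⟨ht, htS⟩
    refine ⟨⟨by linarith [ht.1], by linarith [ht.2]⟩, fun hmem => htS ?_⟩
    rw [Finset.coe_image]
    exact ⟨t + c, hmem, add_sub_cancel_right t c⟩

theorem weightedLength_translate (K : X → ℝ) (γ : ℝ → X) (a b c : ℝ) :
    weightedLength K (γ ∘ (· + c)) (Ioo (a - c) (b - c)) = weightedLength K γ (Ioo a b) := by
  rw [weightedLength_comp K γ (ψ := (· + c)) measurableSet_Ioo
    (fun u _ => (hasStrictDerivAt_id u).add_const c)
    (fun _ _ => one_ne_zero) (add_left_injective c).injOn]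
  simp

theorem exists_isArc_concat (K : X → ℝ) {γ δ : ℝ → X} {a b c : ℝ} {x y z : X}
    (hγ : IsArc γ a b x y) (hδ : IsArc δ b c y z) :
    ∃ η, IsArc η a c x z ∧ weightedLength K η (Ioo a c) =
      weightedLength K γ (Ioo a b) + weightedLength K δ (Ioo b c) := by
  set η : ℝ → X := fun t => if t ≤ b then γ t else δ t with hη
  have h1 : EqOn η γ (Iic b) := fun t ht => if_pos ht
  have h2 : EqOn η δ (Ici b) := fun t ht => by
    rcases eq_or_lt_of_le (mem_Ici.1 ht) with rfl | hlt
    · simp [hη, hγ.right, hδ.left]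
    · exact if_neg hlt.not_ge
  have hab := hγ.lt
  have hbc := hδ.lt
  refine ⟨η, ⟨hab.trans hbc, ?_, ?_, ?_, ?_⟩, ?_⟩
  · rw [← Icc_union_Icc_eq_Icc hab.le hbc.le]
    exact (hγ.continuousOn.congr (h1.mono Icc_subset_Iic_self)).union_of_isClosed
      (hδ.continuousOn.congr (h2.mono Icc_subset_Ici_self)) isClosed_Icc isClosed_Icc
  · rw [h1 hab.le, hγ.left]
  · rw [h2 hbc.le, hδ.right]
  · obtain ⟨S, hS⟩ := hγ.locallyLipschitz
    obtain ⟨T, hT⟩ := hδ.locallyLipschitz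
    refine ⟨insert b (S ∪ T), locallyLipschitzOnSet_of_nhds ?_⟩
    rintro t ⟨ht, htS⟩
    simp only [Finset.coe_insert, Finset.coe_union, mem_insert_iff, mem_union, not_or] at htS
    rcases lt_or_gt_of_ne htS.1 with hlt | hgt
    · refine ⟨Iio b, Iio_mem_nhds hlt, (hS.mono ?_).congr
        (h1.mono fun u hu => (mem_Iio.1 hu.2).le)⟩
      rintro u ⟨⟨hu, huS⟩, hub⟩
      simp only [Finset.coe_insert, Finset.coe_union, mem_insert_iff, mem_union, not_or] at huS
      exact ⟨⟨hu.1, hub⟩, huS.2.1⟩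
    · refine ⟨Ioi b, Ioi_mem_nhds hgt, (hT.mono ?_).congr
        (h2.mono fun u hu => (mem_Ioi.1 hu.2).le)⟩
      rintro u ⟨⟨hu, huS⟩, hub⟩
      simp only [Finset.coe_insert, Finset.coe_union, mem_insert_iff, mem_union, not_or] at huS
      exact ⟨⟨hub, hu.2⟩, huS.2.2⟩
  · rw [← weightedLength_congr K isOpen_Ioo (h1.mono fun u hu => (mem_Ioo.1 hu).2.le),
      ← weightedLength_congr K isOpen_Ioo (h2.mono fun u hu => (mem_Ioo.1 hu).1.le)]
    rw [weightedLength, weightedLength, weightedLength,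
      setLIntegral_congr (Ioo_ae_eq_Ioc (a := a) (b := b)), ← lintegral_union measurableSet_Ioo,
      Ioc_union_Ioo_eq_Ioo hab.le hbc]
    exact disjoint_left.2 fun u hu hu' => hu.2.not_gt hu'.1

/-- Any path can be reparametrized, and extended to its endpoints, on a compact interval. -/
theorem exists_isArc_le_KLength (K : X → ℝ) {γ : ℝ → X} {I : Set ℝ} {x y : X}
    (hpl : PiecewiseLocLipOn γ I) (hpath : IsPathOn γ I x y) :
    ∃ δ a b, IsArc δ a b x y ∧ weightedLength K δ (Ioo a b) ≤ KLength K γ I := by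
  by_cases hxy : x = y
  · subst hxy
    exact ⟨_, 0, 1, isArc_const x, by simp [weightedLength_const]⟩
  obtain ⟨hne, hconn, hcont, hleft, hright⟩ := hpath
  set J := Real.arctan '' I with hJ
  set γ₁ : ℝ → X := γ ∘ Real.tan with hγ₁
  have hJπ : J ⊆ Ioo (-(Real.pi / 2)) (Real.pi / 2) := by
    rintro _ ⟨t, -, rfl⟩
    exact Real.arctan_mem_Ioo t
  have hJne : J.Nonempty := hne.image _
  have hbb : BddBelow J := bddBelow_Ioo.mono hJπ
  have hba : BddAbove J := bddAbove_Ioo.mono hJπ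
  have hJconn : J.OrdConnected :=
    (hconn.isPreconnected.image _ Real.continuous_arctan.continuousOn).ordConnected
  have htanJ : MapsTo Real.tan J I := by
    rintro _ ⟨t, ht, rfl⟩
    rwa [Real.tan_arctan]
  have htan_image : Real.tan '' J = I := by
    rw [hJ, image_image]
    simp
  set a := sInf J with ha
  set b := sSup J with hb
  have hsub : Ioo a b ⊆ J := fun t ht => by
    obtain ⟨u, hu, hut⟩ := exists_lt_of_csInf_lt hJne ht.1
    obtain ⟨v, hv, htv⟩ := exists_lt_of_lt_csSup hJne ht.2
    exact hJconn.out hu hv ⟨hut.le, htv.le⟩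
  have htan_lt : ∀ t ∈ J, ∀ M, t < Real.arctan M → Real.tan t < M := by
    rintro _ ⟨t, -, rfl⟩ M hM
    rw [Real.tan_arctan]
    exact Real.arctan_strictMono.lt_iff_lt.1 hM
  have hlt_tan : ∀ t ∈ J, ∀ M, Real.arctan M < t → M < Real.tan t := by
    rintro _ ⟨t, -, rfl⟩ M hM
    rw [Real.tan_arctan]
    exact Real.arctan_strictMono.lt_iff_lt.1 hM
  have hab : a < b := by
    refine lt_of_le_of_ne (csInf_le_csSup hJne hbb hba) fun heq => hxy ?_
    obtain ⟨c, hc⟩ := hne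
    have hI : I = {c} := by
      refine eq_singleton_iff_unique_mem.2 ⟨hc, fun t ht => Real.arctan_injective ?_⟩
      have h1 := csInf_le hbb (mem_image_of_mem Real.arctan ht)
      have h2 := csInf_le hbb (mem_image_of_mem Real.arctan hc)
      have h3 := le_csSup hba (mem_image_of_mem Real.arctan ht)
      have h4 := le_csSup hba (mem_image_of_mem Real.arctan hc)
      linarith
    rw [leftEndFilter, hI, if_pos (by simp)] at hleft
    rw [rightEndFilter, hI, if_pos (by simp)] at hright
    simp only [csInf_singleton, csSup_singleton, nhdsWithin_singleton] at hleft hright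
    exact tendsto_nhds_unique hleft hright
  have hstrict : ∀ u ∈ J, HasStrictDerivAt Real.tan (1 / Real.cos u ^ 2) u := fun u hu =>
    Real.hasStrictDerivAt_tan (Real.cos_pos_of_mem_Ioo (hJπ hu)).ne'
  have hcont₁ : ContinuousOn γ₁ (Ioo a b) := by
    refine (hcont.comp ?_ htanJ).mono hsub
    exact fun u hu => (hstrict u hu).hasDerivAt.continuousAt.continuousWithinAt
  have hmemL : ∀ M, (∃ i ∈ I, i < M) → ∀ᶠ t in 𝓝[>] a, Real.tan t ∈ I ∧ Real.tan t < M := by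
    rintro M ⟨i, hi, hiM⟩
    have haM : a < Real.arctan M :=
      (csInf_le hbb (mem_image_of_mem _ hi)).trans_lt (Real.arctan_strictMono hiM)
    filter_upwards [Ioo_mem_nhdsGT hab, Ioo_mem_nhdsGT haM] with t ht ht'
    exact ⟨htanJ (hsub ht), htan_lt t (hsub ht) M ht'.2⟩
  have hmemR : ∀ M, (∃ i ∈ I, M < i) → ∀ᶠ t in 𝓝[<] b, Real.tan t ∈ I ∧ M < Real.tan t := by
    rintro M ⟨i, hi, hiM⟩
    have hbM : Real.arctan M < b :=
      (Real.arctan_strictMono hiM).trans_le (le_csSup hba (mem_image_of_mem _ hi))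
    filter_upwards [Ioo_mem_nhdsLT hab, Ioo_mem_nhdsLT hbM] with t ht ht'
    exact ⟨htanJ (hsub ht), hlt_tan t (hsub ht) M ht'.1⟩
  have hIleft : ∀ᶠ t in 𝓝[>] a, Real.tan t ∈ I := by
    filter_upwards [Ioo_mem_nhdsGT hab] with t ht using htanJ (hsub ht)
  have hIright : ∀ᶠ t in 𝓝[<] b, Real.tan t ∈ I := by
    filter_upwards [Ioo_mem_nhdsLT hab] with t ht using htanJ (hsub ht)
  have hL : Tendsto Real.tan (𝓝[>] a) (leftEndFilter I) := by
    unfold leftEndFilter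
    split_ifs with hB
    · refine tendsto_nhdsWithin_iff.2 ⟨tendsto_order.2 ⟨fun l hl => ?_, fun M hM => ?_⟩, hIleft⟩
      · filter_upwards [hIleft] with t ht using hl.trans_le (csInf_le hB ht)
      · exact (hmemL M (exists_lt_of_csInf_lt hne hM)).mono fun t ht => ht.2
    · refine tendsto_inf.2 ⟨tendsto_atBot.2 fun M => ?_, tendsto_principal.2 hIleft⟩
      exact (hmemL M (not_bddBelow_iff.1 hB M)).mono fun t ht => ht.2.le
  have hR : Tendsto Real.tan (𝓝[<] b) (rightEndFilter I) := by
    unfold rightEndFilter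
    split_ifs with hB
    · refine tendsto_nhdsWithin_iff.2 ⟨tendsto_order.2 ⟨fun l hl => ?_, fun M hM => ?_⟩, hIright⟩
      · exact (hmemR l (exists_lt_of_lt_csSup hne hl)).mono fun t ht => ht.2
      · filter_upwards [hIright] with t ht using (le_csSup hB ht).trans_lt hM
    · refine tendsto_inf.2 ⟨tendsto_atTop.2 fun M => ?_, tendsto_principal.2 hIright⟩
      exact (hmemR M (not_bddAbove_iff.1 hB M)).mono fun t ht => ht.2.le
  have hL₁ : Tendsto γ₁ (𝓝[>] a) (𝓝 x) := hleft.comp hL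
  have hR₁ : Tendsto γ₁ (𝓝[<] b) (𝓝 y) := hright.comp hR
  have heq : EqOn (extendFrom (Ioo a b) γ₁) γ₁ (Ioo a b) := fun t ht =>
    extendFrom_eq (subset_closure ht) (hcont₁ t ht)
  refine ⟨extendFrom (Ioo a b) γ₁, a, b, ⟨hab, ?_, ?_, ?_, ?_⟩, ?_⟩
  · exact continuousOn_Icc_extendFrom_Ioo hcont₁ hL₁ hR₁
  · exact eq_lim_at_left_extendFrom_Ioo hab hL₁
  · exact eq_lim_at_right_extendFrom_Ioo hab hR₁
  · obtain ⟨S, hS⟩ := hpl.2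
    refine ⟨S.image Real.arctan, LocallyLipschitzOnSet.congr ?_ (heq.mono sdiff_subset)⟩
    refine hS.comp (fun u hu => hstrict u (hsub hu.1)) ?_
    rintro t ⟨ht, htS⟩
    refine ⟨htanJ (hsub ht), fun hmem => htS ?_⟩
    rw [Finset.coe_image]
    have := hJπ (hsub ht)
    exact ⟨Real.tan t, hmem, Real.arctan_tan this.1 this.2⟩
  · rw [weightedLength_congr K isOpen_Ioo heq, KLength_eq_weightedLength K γ hconn, ← htan_image,
      ← weightedLength_comp K γ hJconn.measurableSet hstrict]
    · exact lintegral_mono_set hsub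
    · intro u hu
      have := Real.cos_pos_of_mem_Ioo (hJπ hu)
      positivity
    · exact Real.injOn_tan.mono hJπ

theorem le_dK {K : X → ℝ} {x y : X} {C : ℝ≥0∞}
    (h : ∀ γ a b, IsArc γ a b x y → C ≤ weightedLength K γ (Ioo a b)) : C ≤ dK K x y := by
  refine le_iInf fun γ => le_iInf fun I => le_iInf fun hpl => le_iInf fun hpath => ?_
  obtain ⟨δ, a, b, hδ, hle⟩ := exists_isArc_le_KLength K hpl hpath
  exact (h δ a b hδ).trans hle

theorem dK_self (K : X → ℝ) (x : X) : dK K x x = 0 :=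
  le_antisymm (((isArc_const x).dK_le K).trans_eq (weightedLength_const K x _)) zero_le

theorem dK_comm (K : X → ℝ) (x y : X) : dK K x y = dK K y x := by
  have key : ∀ x y, dK K x y ≤ dK K y x := fun x y => le_dK fun γ a b h =>
    (h.reverse.dK_le K).trans_eq (weightedLength_reverse K γ a b)
  exact le_antisymm (key x y) (key y x)

theorem dK_triangle (K : X → ℝ) (x y z : X) : dK K x z ≤ dK K x y + dK K y z := by
  have key : ∀ γ a b, IsArc γ a b x y → dK K x z ≤ dK K y z + weightedLength K γ (Ioo a b) := by
    intro γ a b hγ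
    rw [← tsub_le_iff_right]
    refine le_dK fun δ c d hδ => tsub_le_iff_left.2 ?_
    have hδ' := hδ.translate (c - b)
    rw [sub_sub_cancel] at hδ'
    obtain ⟨η, hη, hlen⟩ := exists_isArc_concat K hγ hδ'
    have htr := weightedLength_translate K δ c d (c - b)
    rw [sub_sub_cancel] at htr
    rw [← htr, ← hlen]
    exact hη.dK_le K
  rw [← tsub_le_iff_right]
  exact le_dK fun γ a b hγ => tsub_le_iff_left.2 (key γ a b hγ)

end Arcs

section Positivity

variable {X : Type*} [MetricSpace X]

theorem LocallyLipschitzOnSet.volume_not_hasMetricDeriv {γ : ℝ → X} {U : Set ℝ} (hU : IsOpen U)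
    (h : LocallyLipschitzOnSet γ U) :
    volume {t ∈ U | ¬ ∃ L, HasMetricDerivWithinAt γ univ t L} = 0 := by
  refine measure_null_of_locally_null _ fun t ht => ?_
  obtain ⟨ε, hε, C, hC⟩ := h t ht.1
  obtain ⟨r, hr, hrU⟩ := Metric.nhds_basis_closedBall.mem_iff.1
    (inter_mem (hU.mem_nhds ht.1) (Metric.ball_mem_nhds t hε))
  rw [Real.closedBall_eq_Icc] at hrU
  have hle : t - r ≤ t + r := by linarith
  have hlip : LipschitzWith C (IccExtend hle ((Icc (t - r) (t + r)).domRestrict γ)) := by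
    have := (hC.mono hrU).to_restrict.comp (LipschitzWith.projIcc hle)
    rwa [mul_one] at this
  refine ⟨_, inter_mem_nhdsWithin _ (Ioo_mem_nhds (show t - r < t by linarith)
    (show t < t + r by linarith)), measure_mono_null ?_ hlip.ae_exists_hasMetricDeriv⟩
  rintro s ⟨⟨-, hs⟩, hsI⟩ ⟨L, hL⟩
  refine hs ⟨L, ?_⟩
  have heq : IccExtend hle ((Icc (t - r) (t + r)).domRestrict γ) =ᶠ[𝓝 s] γ := by
    filter_upwards [Ioo_mem_nhds hsI.1 hsI.2] with u hu
    rw [IccExtend_of_mem _ _ (Ioo_subset_Icc_self hu)]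
    rfl
  rw [HasMetricDerivWithinAt, heq.eq_of_nhds] at hL
  refine hL.congr' ?_
  filter_upwards [nhdsWithin_le_nhds heq] with u hu
  rw [hu]

theorem LocallyLipschitzOnSet.volume_not_differentiableAt {f : ℝ → ℝ} {U : Set ℝ} (hU : IsOpen U)
    (h : LocallyLipschitzOnSet f U) : volume (U \ {t | DifferentiableAt ℝ f t}) = 0 := by
  refine measure_null_of_locally_null _ fun t ht => ?_
  obtain ⟨ε, hε, C, hC⟩ := h t ht.1
  have hopen : IsOpen (U ∩ Metric.ball t ε) := hU.inter Metric.isOpen_ball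
  refine ⟨_, inter_mem_nhdsWithin _ (Metric.ball_mem_nhds t hε),
    measure_mono_null ?_ hC.ae_differentiableWithinAt_of_mem_real⟩
  rintro s ⟨⟨hsU, hs⟩, hsb⟩ hd
  exact hs ((hd ⟨hsU, hsb⟩).differentiableAt (hopen.mem_nhds ⟨hsU, hsb⟩))

theorem LocallyLipschitzOnSet.volume_image_eq_zero {f : ℝ → ℝ} {U N : Set ℝ}
    (h : LocallyLipschitzOnSet f U) (hNU : N ⊆ U) (hN : volume N = 0) : volume (f '' N) = 0 := by
  choose! ε hε C hC using h
  obtain ⟨T, hTN, hTc, hT⟩ := TopologicalSpace.countable_cover_nhdsWithin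
    (f := fun t => Metric.ball t (ε t)) (s := N) fun t ht =>
      mem_nhdsWithin_of_mem_nhds (Metric.ball_mem_nhds t (hε t (hNU ht)))
  have hsub : f '' N ⊆ ⋃ t ∈ T, f '' (N ∩ Metric.ball t (ε t)) := by
    rintro _ ⟨s, hs, rfl⟩
    obtain ⟨t, ht, hst⟩ := mem_iUnion₂.1 (hT hs)
    exact mem_iUnion₂.2 ⟨t, ht, mem_image_of_mem f ⟨hs, hst⟩⟩
  refine measure_mono_null hsub ((measure_biUnion_null_iff hTc).2 fun t ht => ?_)
  have hL := ((hC t (hNU (hTN ht))).mono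
    (inter_subset_inter_left _ hNU)).hausdorffMeasure_image_le (d := 1) zero_le_one
  rw [hausdorffMeasure_real, measure_mono_null inter_subset_left hN, mul_zero] at hL
  exact le_antisymm hL zero_le

theorem abs_deriv_dist_le_metricDeriv {γ : ℝ → X} {x : X} {t L : ℝ}
    (hd : DifferentiableAt ℝ (fun s => dist x (γ s)) t) (h : HasMetricDerivWithinAt γ univ t L) :
    |deriv (fun s => dist x (γ s)) t| ≤ L := by
  rw [HasMetricDerivWithinAt, ← compl_eq_univ_sdiff] at h
  refine le_of_tendsto_of_tendsto' (hasDerivAt_iff_tendsto_slope.1 hd.hasDerivAt).abs h fun s => ?_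
  rw [slope_def_field, abs_div]
  gcongr
  simpa [dist_comm] using abs_dist_sub_le (γ s) (γ t) x

/-- A curve leaving `x` has to cross every annulus around `x` that separates its endpoints. -/
theorem IsArc.le_weightedLength_of_annulus {K : X → ℝ} {γ : ℝ → X} {a b r R c : ℝ} {x y : X}
    (h : IsArc γ a b x y) (hr : 0 ≤ r) (hR : R ≤ dist x y) (hc : 0 ≤ c)
    (hK : ∀ z, r < dist x z → dist x z < R → c ≤ K z) :
    ENNReal.ofReal c * ENNReal.ofReal (R - r) ≤ weightedLength K γ (Ioo a b) := by
  obtain ⟨S, hS⟩ := h.locallyLipschitz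
  set f : ℝ → ℝ := fun t => dist x (γ t) with hf
  set U := Ioo a b \ (S : Set ℝ) with hU
  have hUo : IsOpen U := isOpen_Ioo.sdiff S.finite_toSet.isClosed
  have hfc : ContinuousOn f (Icc a b) :=
    fun t ht => tendsto_const_nhds.dist (h.continuousOn t ht)
  have hUab : U ⊆ Icc a b := sdiff_subset.trans Ioo_subset_Icc_self
  have hfl : LocallyLipschitzOnSet f U := fun t ht => by
    obtain ⟨ε, hε, C, hC⟩ := hS t ht
    refine ⟨ε, hε, C, ?_⟩
    simpa [Function.comp_def] using (LipschitzWith.dist_right x).comp_lipschitzOnWith hC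
  set D := {t | DifferentiableAt ℝ f t} with hD
  set V := U ∩ f ⁻¹' Ioo r R with hV
  have hVo : IsOpen V := (hfc.mono hUab).isOpen_inter_preimage hUo isOpen_Ioo
  have hEm : MeasurableSet (V ∩ D) :=
    hVo.measurableSet.inter (measurableSet_of_differentiableAt ℝ f)
  have hcover : Ioo r R ⊆ f '' (V ∩ D) ∪ (f '' S ∪ f '' (U \ D)) := by
    intro v hv
    have hv' : v ∈ Ioo (f a) (f b) := by
      simp only [hf, h.left, h.right, dist_self]
      exact ⟨hr.trans_lt hv.1, hv.2.trans_le hR⟩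
    obtain ⟨t, ht, rfl⟩ := intermediate_value_Ioo h.lt.le hfc hv'
    by_cases htS : t ∈ (S : Set ℝ)
    · exact Or.inr (Or.inl (mem_image_of_mem f htS))
    by_cases htD : t ∈ D
    · exact Or.inl (mem_image_of_mem f ⟨⟨⟨ht, htS⟩, hv⟩, htD⟩)
    · exact Or.inr (Or.inr (mem_image_of_mem f ⟨⟨ht, htS⟩, htD⟩))
  have hnull : volume (f '' S ∪ f '' (U \ D)) = 0 := by
    refine measure_union_null ((S.finite_toSet.image f).measure_zero _) ?_
    exact hfl.volume_image_eq_zero sdiff_subset (hfl.volume_not_differentiableAt hUo)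
  have hvol : ENNReal.ofReal (R - r) ≤ ∫⁻ t in V ∩ D, ENNReal.ofReal |deriv f t| := by
    calc ENNReal.ofReal (R - r) = volume (Ioo r R) := Real.volume_Ioo.symm
      _ ≤ volume (f '' (V ∩ D)) + volume (f '' S ∪ f '' (U \ D)) :=
        (measure_mono hcover).trans (measure_union_le _ _)
      _ = volume (f '' (V ∩ D)) := by rw [hnull, add_zero]
      _ ≤ _ := by
        simpa only [ContinuousLinearMap.det_toSpanSingleton] using
          addHaar_image_le_lintegral_abs_det_fderiv volume hEm fun t ht =>
            (DifferentiableAt.hasDerivAt ht.2).hasDerivWithinAt.hasFDerivWithinAt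
  have hmd : ∀ᵐ t, ¬ (t ∈ U ∧ ¬ ∃ L, HasMetricDerivWithinAt γ univ t L) :=
    measure_eq_zero_iff_ae_notMem.1 (hS.volume_not_hasMetricDeriv hUo)
  calc ENNReal.ofReal c * ENNReal.ofReal (R - r)
      ≤ ENNReal.ofReal c * ∫⁻ t in V ∩ D, ENNReal.ofReal |deriv f t| := by gcongr
    _ = ∫⁻ t in V ∩ D, ENNReal.ofReal c * ENNReal.ofReal |deriv f t| :=
      (lintegral_const_mul' _ _ ENNReal.ofReal_ne_top).symm
    _ ≤ ∫⁻ t in V ∩ D, ENNReal.ofReal (K (γ t) * metricDerivWithin γ univ t) := by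
      refine lintegral_mono_ae ?_
      rw [ae_restrict_iff' hEm]
      filter_upwards [hmd] with t ht htE
      push Not at ht
      obtain ⟨L, hL⟩ := ht htE.1.1
      have hle := abs_deriv_dist_le_metricDeriv htE.2 hL
      rw [← ENNReal.ofReal_mul hc, hL.metricDerivWithin_univ_eq]
      have hKt := hK (γ t) htE.1.2.1 htE.1.2.2
      exact ENNReal.ofReal_le_ofReal (mul_le_mul hKt hle (abs_nonneg _) (hc.trans hKt))
    _ ≤ weightedLength K γ (Ioo a b) :=
      lintegral_mono_set fun t ht => ht.1.1.1

theorem dK_pos [ProperSpace X] {K : X → ℝ} (hKc : Continuous K) (hK0 : ∀ x, 0 ≤ K x)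
    (hfin : {x : X | K x = 0}.Finite) {x y : X} (hxy : x ≠ y) : 0 < dK K x y := by
  have hcl : IsClosed ({z : X | K z = 0} \ {x}) := (hfin.subset sdiff_subset).isClosed
  obtain ⟨ρ, hρ, hρs⟩ := Metric.isOpen_iff.1 hcl.isOpen_compl x (by simp)
  have hd := dist_pos.2 hxy
  set R := min ρ (dist x y) / 2 with hRdef
  have hRpos : 0 < R := half_pos (lt_min hρ hd)
  have hRρ : R < ρ := (half_lt_self (lt_min hρ hd)).trans_le (min_le_left _ _)
  have hRd : R ≤ dist x y := (half_lt_self (lt_min hρ hd)).le.trans (min_le_right _ _)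
  have hcomp : IsCompact (Metric.closedBall x R \ Metric.ball x (R / 2)) :=
    (isCompact_closedBall x R).diff Metric.isOpen_ball
  obtain ⟨c, hc, hcK⟩ : ∃ c, 0 < c ∧
      ∀ z ∈ Metric.closedBall x R \ Metric.ball x (R / 2), c ≤ K z := by
    refine hcomp.exists_forall_le' hKc.continuousOn fun z hz => ?_
    refine lt_of_le_of_ne (hK0 z) fun h0 => ?_
    refine hρs (Metric.closedBall_subset_ball hRρ hz.1) ⟨h0.symm, ?_⟩
    rintro rfl
    exact hz.2 (Metric.mem_ball_self (half_pos hRpos))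
  have hlow : ENNReal.ofReal c * ENNReal.ofReal (R - R / 2) ≤ dK K x y := by
    refine le_dK fun γ a b h => h.le_weightedLength_of_annulus (half_pos hRpos).le hRd hc.le ?_
    intro z h1 h2
    refine hcK z ⟨?_, ?_⟩
    · simpa [dist_comm] using h2.le
    · simpa [dist_comm] using h1.le
  refine lt_of_lt_of_le (ENNReal.mul_pos ?_ ?_) hlow
  · simpa using hc
  · simpa using hRpos

end Positivity

section Finiteness

variable {X : Type*} [MetricSpace X]

theorem frequently_rightEndFilter {I : Set ℝ} {p : ℝ} (hp : p ∈ I) :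
    ∃ᶠ t in rightEndFilter I, t ∈ I ∧ p ≤ t := by
  unfold rightEndFilter
  split_ifs with hB
  · have h := ((isLUB_csSup ⟨p, hp⟩ hB).inter_Ici_of_mem hp).mem_closure ⟨p, hp, mem_Ici.2 le_rfl⟩
    rw [frequently_nhdsWithin_iff]
    exact (mem_closure_iff_frequently.1 h).mono fun t ht => ⟨ht, ht.1⟩
  · rw [frequently_inf_principal, frequently_atTop]
    intro M
    obtain ⟨i, hi, hM⟩ := not_bddAbove_iff.1 hB (max M p)
    exact ⟨i, (le_max_left _ _).trans hM.le, hi, hi, (le_max_right _ _).trans hM.le⟩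

theorem frequently_leftEndFilter {I : Set ℝ} {p : ℝ} (hp : p ∈ I) :
    ∃ᶠ t in leftEndFilter I, t ∈ I ∧ t ≤ p := by
  unfold leftEndFilter
  split_ifs with hB
  · have h := ((isGLB_csInf ⟨p, hp⟩ hB).inter_Iic_of_mem hp).mem_closure ⟨p, hp, mem_Iic.2 le_rfl⟩
    rw [frequently_nhdsWithin_iff]
    exact (mem_closure_iff_frequently.1 h).mono fun t ht => ⟨ht, ht.1⟩
  · rw [frequently_inf_principal, frequently_atBot]
    intro M
    obtain ⟨i, hi, hM⟩ := not_bddBelow_iff.1 hB (min M p)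
    exact ⟨i, hM.le.trans (min_le_left _ _), hi, hi, hM.le.trans (min_le_right _ _)⟩

theorem IsPathOn.dist_right_le {γ : ℝ → X} {I : Set ℝ} {x y : X} (h : IsPathOn γ I x y) {p C : ℝ}
    (hp : p ∈ I) (hC : ∀ t ∈ I, p ≤ t → dist (γ t) (γ p) ≤ C) : dist y (γ p) ≤ C :=
  Metric.isClosed_closedBall.mem_of_frequently_of_tendsto
    ((frequently_rightEndFilter hp).mono fun t ht => hC t ht.1 ht.2) h.2.2.2.2

theorem IsPathOn.dist_left_le {γ : ℝ → X} {I : Set ℝ} {x y : X} (h : IsPathOn γ I x y) {p C : ℝ}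
    (hp : p ∈ I) (hC : ∀ t ∈ I, t ≤ p → dist (γ t) (γ p) ≤ C) : dist x (γ p) ≤ C :=
  Metric.isClosed_closedBall.mem_of_frequently_of_tendsto
    ((frequently_leftEndFilter hp).mono fun t ht => hC t ht.1 ht.2) h.2.2.2.1

/-- A path whose increments are controlled by those of a bounded function `W` has a
`1`-Lipschitz reparametrization on a bounded open interval. -/
theorem IsPathOn.exists_lipschitz_reparametrization {γ : ℝ → X} {I : Set ℝ} {x y : X}
    (h : IsPathOn γ I x y) (hxy : x ≠ y) {W : ℝ → ℝ}
    (hW : ∀ s ∈ I, ∀ t ∈ I, s ≤ t → dist (γ s) (γ t) ≤ W t - W s)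
    (hbb : BddBelow (W '' I)) (hba : BddAbove (W '' I)) :
    ∃ g a b, a < b ∧ LipschitzOnWith 1 g (Ioo a b) ∧ IsPathOn g (Ioo a b) x y := by
  have hne : I.Nonempty := h.1
  have hconn : I.OrdConnected := h.2.1
  have hcont : ContinuousOn γ I := h.2.2.1
  have hne' := hne.image W
  set a := sInf (W '' I)
  set b := sSup (W '' I)
  have haW : ∀ t ∈ I, a ≤ W t := fun t ht => csInf_le hbb (mem_image_of_mem W ht)
  have hWb : ∀ t ∈ I, W t ≤ b := fun t ht => le_csSup hba (mem_image_of_mem W ht)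
  have hmono : ∀ s ∈ I, ∀ t ∈ I, s ≤ t → W s ≤ W t := fun s hs t ht hst =>
    sub_nonneg.1 (dist_nonneg.trans (hW s hs t ht hst))
  have hab : a < b := by
    by_contra! hba'
    obtain ⟨p, hp⟩ := hne
    have h1 : dist y (γ p) ≤ 0 := h.dist_right_le hp fun t ht hpt => by
      rw [dist_comm]
      linarith [hW p hp t ht hpt, haW p hp, hWb t ht]
    have h2 : dist x (γ p) ≤ 0 := h.dist_left_le hp fun t ht hpt => by
      linarith [hW t ht p hp hpt, haW t ht, hWb p hp]
    exact hxy ((dist_le_zero.1 h2).trans (dist_le_zero.1 h1).symm)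
  set T : ℝ → ℝ := fun s => sSup {t ∈ I | W t ≤ s} with hT
  have hAne : ∀ s ∈ Ioo a b, {t ∈ I | W t ≤ s}.Nonempty := fun s hs => by
    obtain ⟨_, ⟨t, ht, rfl⟩, hts⟩ := exists_lt_of_csInf_lt hne' hs.1
    exact ⟨t, ht, hts.le⟩
  have hAub : ∀ s, ∀ t ∈ I, s < W t → t ∈ upperBounds {t ∈ I | W t ≤ s} := by
    intro s t ht hst u hu
    by_contra! htu
    linarith [hmono t ht u hu.1 htu.le, hu.2]
  have hAbdd : ∀ s ∈ Ioo a b, BddAbove {t ∈ I | W t ≤ s} := fun s hs => by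
    obtain ⟨_, ⟨t, ht, rfl⟩, hts⟩ := exists_lt_of_lt_csSup hne' hs.2
    exact ⟨t, hAub s t ht hts⟩
  have hTI : ∀ s ∈ Ioo a b, T s ∈ I := fun s hs => by
    obtain ⟨_, ⟨t, ht, rfl⟩, hts⟩ := exists_lt_of_lt_csSup hne' hs.2
    obtain ⟨u, hu⟩ := hAne s hs
    exact hconn.out hu.1 ht ⟨le_csSup (hAbdd s hs) hu, csSup_le (hAne s hs) (hAub s t ht hts)⟩
  have hlt : ∀ s ∈ Ioo a b, ∀ t ∈ I, t < T s → W t ≤ s := fun s hs t ht hts => by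
    obtain ⟨u, hu, htu⟩ := exists_lt_of_lt_csSup (hAne s hs) hts
    exact (hmono t ht u hu.1 htu.le).trans hu.2
  have hgt : ∀ s ∈ Ioo a b, ∀ t ∈ I, T s < t → s < W t := fun s hs t ht hts => by
    by_contra! hle
    exact hts.not_ge (le_csSup (hAbdd s hs) ⟨ht, hle⟩)
  have hdl : ∀ s ∈ Ioo a b, ∀ t ∈ I, t < T s → dist (γ t) (γ (T s)) ≤ s - W t := by
    intro s hs t ht hts
    have hsub : Ico t (T s) ⊆ I := fun u hu => hconn.out ht (hTI s hs) ⟨hu.1, hu.2.le⟩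
    have hlim : Tendsto γ (𝓝[Ico t (T s)] (T s)) (𝓝 (γ (T s))) :=
      (hcont _ (hTI s hs)).mono_left (nhdsWithin_mono _ hsub)
    rw [nhdsWithin_Ico_eq_nhdsLT hts] at hlim
    refine le_of_tendsto (tendsto_const_nhds.dist hlim) ?_
    filter_upwards [Ico_mem_nhdsLT hts] with u hu
    linarith [hW t ht u (hsub hu) hu.1, hlt s hs u (hsub hu) hu.2]
  have hdr : ∀ s ∈ Ioo a b, ∀ t ∈ I, T s < t → dist (γ t) (γ (T s)) ≤ W t - s := by
    intro s hs t ht hts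
    have hsub : Ioc (T s) t ⊆ I := fun u hu => hconn.out (hTI s hs) ht ⟨hu.1.le, hu.2⟩
    have hlim : Tendsto γ (𝓝[Ioc (T s) t] (T s)) (𝓝 (γ (T s))) :=
      (hcont _ (hTI s hs)).mono_left (nhdsWithin_mono _ hsub)
    rw [nhdsWithin_Ioc_eq_nhdsGT hts] at hlim
    refine le_of_tendsto (tendsto_const_nhds.dist hlim) ?_
    filter_upwards [Ioc_mem_nhdsGT hts] with u hu
    rw [dist_comm]
    linarith [hW u (hsub hu) t ht hu.2, hgt s hs u (hsub hu) hu.1]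
  have hdist : ∀ s ∈ Ioo a b, ∀ s' ∈ Ioo a b, s ≤ s' →
      dist (γ (T s)) (γ (T s')) ≤ s' - s := by
    intro s hs s' hs' hss
    have hTT : T s ≤ T s' := csSup_le_csSup (hAbdd s' hs') (hAne s hs)
      fun t ht => ⟨ht.1, ht.2.trans hss⟩
    rcases hTT.eq_or_lt with heq | hTlt
    · rw [heq, dist_self]
      linarith
    · obtain ⟨u, hu1, hu2⟩ := exists_between hTlt
      have hu : u ∈ I := hconn.out (hTI s hs) (hTI s' hs') ⟨hu1.le, hu2.le⟩
      have h1 := hdr s hs u hu hu1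
      have h2 := hdl s' hs' u hu hu2
      linarith [dist_triangle_left (γ (T s)) (γ (T s')) (γ u)]
  have hlip : LipschitzOnWith 1 (γ ∘ T) (Ioo a b) := by
    refine LipschitzOnWith.of_dist_le_mul fun s hs s' hs' => ?_
    rw [NNReal.coe_one, one_mul, Real.dist_eq]
    rcases le_total s s' with hss | hss
    · rw [abs_sub_comm]
      exact (hdist s hs s' hs' hss).trans (le_abs_self _)
    · rw [dist_comm]
      exact (hdist s' hs' s hs hss).trans (le_abs_self _)
  have hxl : ∀ s ∈ Ioo a b, dist ((γ ∘ T) s) x ≤ s - a := fun s hs => by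
    rw [dist_comm]
    refine h.dist_left_le (hTI s hs) fun t ht hts => ?_
    rcases hts.eq_or_lt with rfl | hts
    · rw [dist_self]
      linarith [hs.1]
    · linarith [hdl s hs t ht hts, haW t ht]
  have hyr : ∀ s ∈ Ioo a b, dist ((γ ∘ T) s) y ≤ b - s := fun s hs => by
    rw [dist_comm]
    refine h.dist_right_le (hTI s hs) fun t ht hts => ?_
    rcases hts.eq_or_lt with heq | hts
    · rw [← heq, dist_self]
      linarith [hs.2]
    · linarith [hdr s hs t ht hts, hWb t ht]
  refine ⟨γ ∘ T, a, b, hab, hlip, nonempty_Ioo.2 hab, ordConnected_Ioo, hlip.continuousOn, ?_, ?_⟩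
  · rw [leftEndFilter, if_pos bddBelow_Ioo, csInf_Ioo hab, tendsto_iff_dist_tendsto_zero]
    have hlim : Tendsto (fun s => s - a) (𝓝[Ioo a b] a) (𝓝 0) := by
      have : Tendsto (fun s => s - a) (𝓝 a) (𝓝 (a - a)) := tendsto_id.sub_const a
      rw [sub_self] at this
      exact this.mono_left nhdsWithin_le_nhds
    refine squeeze_zero' (Eventually.of_forall fun _ => dist_nonneg) ?_ hlim
    exact eventually_nhdsWithin_of_forall hxl
  · rw [rightEndFilter, if_pos bddAbove_Ioo, csSup_Ioo hab, tendsto_iff_dist_tendsto_zero]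
    have hlim : Tendsto (fun s => b - s) (𝓝[Ioo a b] b) (𝓝 0) := by
      have : Tendsto (fun s => b - s) (𝓝 b) (𝓝 (b - b)) := tendsto_id.const_sub b
      rw [sub_self] at this
      exact this.mono_left nhdsWithin_le_nhds
    refine squeeze_zero' (Eventually.of_forall fun _ => dist_nonneg) ?_ hlim
    exact eventually_nhdsWithin_of_forall hyr

theorem dist_le_eVariationOn_Iic_sub {γ : ℝ → X} {I : Set ℝ} (hfin : eVariationOn γ I ≠ ⊤)
    {s t : ℝ} (hs : s ∈ I) (ht : t ∈ I) (hst : s ≤ t) :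
    dist (γ s) (γ t) ≤
      (eVariationOn γ (I ∩ Iic t)).toReal - (eVariationOn γ (I ∩ Iic s)).toReal := by
  have hf : ∀ r, eVariationOn γ (I ∩ Iic r) ≠ ⊤ := fun r =>
    ne_top_of_le_ne_top hfin (eVariationOn.mono γ inter_subset_left)
  have hsum : eVariationOn γ (I ∩ Iic s) + edist (γ s) (γ t) ≤ eVariationOn γ (I ∩ Iic t) := by
    calc eVariationOn γ (I ∩ Iic s) + edist (γ s) (γ t)
        ≤ eVariationOn γ (I ∩ Iic s) + eVariationOn γ (I ∩ Icc s t) := by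
          gcongr
          exact eVariationOn.edist_le γ ⟨hs, le_rfl, hst⟩ ⟨ht, hst, le_rfl⟩
      _ ≤ eVariationOn γ (I ∩ Iic s ∪ I ∩ Icc s t) :=
          eVariationOn.add_le_union γ fun u hu v hv => (mem_Iic.1 hu.2).trans hv.2.1
      _ ≤ eVariationOn γ (I ∩ Iic t) := by
          refine eVariationOn.mono γ (union_subset ?_ ?_)
          · exact fun u hu => ⟨hu.1, (mem_Iic.1 hu.2).trans hst⟩
          · exact fun u hu => ⟨hu.1, hu.2.2⟩
  have := ENNReal.toReal_mono (hf t) hsum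
  rw [ENNReal.toReal_add (hf s) (edist_ne_top _ _), ← dist_edist] at this
  linarith

theorem dK_ne_top [ProperSpace X] (hlen : IsLengthSpace X) {K : X → ℝ} (hKc : Continuous K)
    (hK0 : ∀ x, 0 ≤ K x) (x y : X) : dK K x y ≠ ⊤ := by
  by_cases hxy : x = y
  · rw [hxy, dK_self]
    exact ENNReal.zero_ne_top
  have hlt : geodDist x y < ⊤ := by
    rw [hlen x y]
    exact edist_lt_top x y
  simp only [geodDist, iInf_lt_iff] at hlt
  obtain ⟨γ, I, hpath, hvar⟩ := hlt
  have hbound : ∀ t, (eVariationOn γ (I ∩ Iic t)).toReal ≤ (eVariationOn γ I).toReal := fun t =>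
    ENNReal.toReal_mono hvar.ne (eVariationOn.mono γ inter_subset_left)
  obtain ⟨g, a, b, hab, hlip, hg⟩ := hpath.exists_lipschitz_reparametrization hxy
    (W := fun t => (eVariationOn γ (I ∩ Iic t)).toReal)
    (fun s hs t ht hst => dist_le_eVariationOn_Iic_sub hvar.ne hs ht hst)
    ⟨0, by rintro _ ⟨t, -, rfl⟩; exact ENNReal.toReal_nonneg⟩
    ⟨_, by rintro _ ⟨t, -, rfl⟩; exact hbound t⟩
  have hpl : PiecewiseLocLipOn g (Ioo a b) :=
    ⟨hlip.continuousOn, ∅, fun _ _ => ⟨1, one_pos, 1, hlip.mono fun u hu => hu.1.1⟩⟩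
  obtain ⟨m, hm⟩ : (Ioo a b).Nonempty := nonempty_Ioo.2 hab
  obtain ⟨M, hM⟩ := (isCompact_closedBall (g m) (b - a)).bddAbove_image hKc.continuousOn
  have hKM : ∀ t ∈ Ioo a b, K (g t) ≤ M := fun t ht => by
    refine hM (mem_image_of_mem K ?_)
    have := hlip.dist_le_mul t ht m hm
    rw [NNReal.coe_one, one_mul, Real.dist_eq] at this
    refine this.trans (abs_le.2 ⟨?_, ?_⟩) <;> linarith [ht.1, ht.2, hm.1, hm.2]
  have hle : dK K x y ≤ weightedLength K g (Ioo a b) := by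
    rw [← KLength_eq_weightedLength K g ordConnected_Ioo]
    exact iInf_le_of_le g <| iInf_le_of_le _ <| iInf_le_of_le hpl <| iInf_le _ hg
  refine ne_top_of_le_ne_top ?_ hle
  have hle' : weightedLength K g (Ioo a b) ≤ ∫⁻ _ in Ioo a b, ENNReal.ofReal M := by
    refine setLIntegral_mono measurable_const fun t ht => ENNReal.ofReal_le_ofReal ?_
    have h1 : metricDerivWithin g univ t ≤ 1 :=
      metricDerivWithin_univ_le (isOpen_Ioo.mem_nhds ht) hlip
    calc K (g t) * metricDerivWithin g univ t ≤ K (g t) * 1 := by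
          gcongr
          exact hK0 _
      _ ≤ M := by
        rw [mul_one]
        exact hKM t ht
  refine ne_top_of_le_ne_top ?_ hle'
  rw [setLIntegral_const, Real.volume_Ioo]
  exact ENNReal.mul_ne_top ENNReal.ofReal_ne_top ENNReal.ofReal_ne_top

end Finiteness

/-- Under hypotheses (H1)-(H3), `d_K` is a metric on `X`: finite, symmetric,
satisfying the triangle inequality, vanishing on the diagonal and positive off it. -/
theorem dK_is_metric
    {X : Type*} [MetricSpace X] [ProperSpace X] (hlen : IsLengthSpace X)
    (K : X → ℝ) (hKc : Continuous K) (hK0 : ∀ x, 0 ≤ K x)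
    (hfin : {x : X | K x = 0}.Finite)
    (k : ℝ → ℝ) (hkc : ContinuousOn k (Set.Ici 0)) (hk0 : ∀ t ∈ Set.Ici (0 : ℝ), 0 ≤ k t)
    (hkdiv : ∫⁻ t in Set.Ioi (0 : ℝ), ENNReal.ofReal (k t) = ⊤)
    (hlow : ∀ x : X, k (Metric.infDist x {x : X | K x = 0}) ≤ K x) :
    (∀ x y : X, dK K x y ≠ ⊤) ∧
    (∀ x y : X, dK K x y = dK K y x) ∧
    (∀ x y z : X, dK K x z ≤ dK K x y + dK K y z) ∧
    (∀ x : X, dK K x x = 0) ∧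
    (∀ x y : X, x ≠ y → 0 < dK K x y) :=
  ⟨dK_ne_top hlen hKc hK0, dK_comm K, dK_triangle K, dK_self K,
    fun _ _ hxy => dK_pos hKc hK0 hfin hxy⟩
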